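/- Suppose z̄ ∈ Z_ad, p̄ ∈ L²(Ω), and λ̄ ∈ ∂ψ(z̄) satisfy the variational inequality (p̄ + σ z̄ + ν λ̄, z − z̄)_{L²} ≥ 0 for all z ∈ Z_ad. Then the subgradient is given by the projection formula λ̄(x) = Proj_{[−1,1]}( −(1/ν) p̄(x) ) for a.e. x ∈ Ω. -/

import Mathlib

open MeasureTheory RealInnerProductSpace

/-- `ψ(z) = ‖z‖_{L¹(Ω)} = ∫_Ω |z| dμ`, the nondifferentiable part of the cost. -/
noncomputable def psi {Ω : Type*} [MeasurableSpace Ω] (μ : Measure Ω) (z : Lp ℝ 2 μ) : ℝ :=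
  ∫ x, |z x| ∂μ

/-- The admissible set `Z_ad = {z ∈ L²(Ω) : a ≤ z ≤ b a.e.}`. -/
def Zad {Ω : Type*} [MeasurableSpace Ω] (μ : Measure Ω) (a b : ℝ) : Set (Lp ℝ 2 μ) :=
  {z | ∀ᵐ x ∂μ, a ≤ z x ∧ z x ≤ b}

/-- `l` is a subgradient of `g` at `z`. -/
def IsSubgradient {Ω : Type*} [MeasurableSpace Ω] {μ : Measure Ω}
    (g : Lp ℝ 2 μ → ℝ) (z l : Lp ℝ 2 μ) : Prop :=
  ∀ w : Lp ℝ 2 μ, ⟪l, w - z⟫ ≤ g w - g z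

/-- The reduced cost functional `f(z) = ½‖Sz−u_d‖² + (σ/2)‖z‖² + ν ψ(z)`. -/
noncomputable def fcost {Ω : Type*} [MeasurableSpace Ω] {μ : Measure Ω}
    (S : Lp ℝ 2 μ →L[ℝ] Lp ℝ 2 μ) (ud : Lp ℝ 2 μ) (σ ν : ℝ) (z : Lp ℝ 2 μ) : ℝ :=
  (1 / 2) * ‖S z - ud‖ ^ 2 + (σ / 2) * ‖z‖ ^ 2 + ν * psi μ z

/-- Projection onto the interval `[c, d]`: `Proj_{[c,d]}(t) = min{d, max{c, t}}`. -/
noncomputable def proj (c d t : ℝ) : ℝ := min d (max c t)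

/-- The restriction of `d ∈ L²` to the measurable set `s`, extended by zero. -/
noncomputable def restrictLp {Ω : Type*} [MeasurableSpace Ω] {μ : Measure Ω} {s : Set Ω}
    (hs : MeasurableSet s) (d : Lp ℝ 2 μ) : Lp ℝ 2 μ :=
  ((Lp.memLp d).indicator hs).toLp

lemma coeFn_restrictLp {Ω : Type*} [MeasurableSpace Ω] {μ : Measure Ω} {s : Set Ω}
    (hs : MeasurableSet s) (d : Lp ℝ 2 μ) : restrictLp hs d =ᵐ[μ] s.indicator d :=
  MemLp.coeFn_toLp _

lemma inner_restrictLp {Ω : Type*} [MeasurableSpace Ω] {μ : Measure Ω} {s : Set Ω}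
    (hs : MeasurableSet s) (g d : Lp ℝ 2 μ) :
    ⟪g, restrictLp hs d⟫ = ∫ x in s, g x * d x ∂μ := by
  rw [L2.inner_def, ← integral_indicator hs]
  refine integral_congr_ae ?_
  filter_upwards [coeFn_restrictLp hs d] with x hx
  by_cases h : x ∈ s <;> simp [hx, h, mul_comm]

lemma integrable_mul_L2 {Ω : Type*} [MeasurableSpace Ω] {μ : Measure Ω} (g d : Lp ℝ 2 μ) :
    Integrable (fun x => g x * d x) μ :=
  (Lp.memLp g).integrable_mul (Lp.memLp d)

lemma psi_add_restrictLp_sub {Ω : Type*} [MeasurableSpace Ω] {μ : Measure Ω}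
    [IsFiniteMeasure μ] {s : Set Ω} (hs : MeasurableSet s) (z d : Lp ℝ 2 μ) :
    psi μ (z + restrictLp hs d) - psi μ z = ∫ x in s, (|z x + d x| - |z x|) ∂μ := by
  have hint : ∀ f : Lp ℝ 2 μ, Integrable (fun x => |f x|) μ := fun f =>
    ((Lp.memLp f).integrable one_le_two).abs
  rw [psi, psi, ← integral_sub (hint _) (hint _), ← integral_indicator hs]
  refine integral_congr_ae ?_
  filter_upwards [coeFn_restrictLp hs d, Lp.coeFn_add z (restrictLp hs d)] with x hx hadd
  rw [hadd, Pi.add_apply, hx]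
  by_cases h : x ∈ s <;> simp [h]

/-- A subgradient of the `L¹`-norm satisfies the subgradient inequality pointwise. -/
lemma IsSubgradient.ae_mul_le {Ω : Type*} [MeasurableSpace Ω] {μ : Measure Ω}
    [IsFiniteMeasure μ] {z l : Lp ℝ 2 μ} (hl : IsSubgradient (psi μ) z l) (d : Lp ℝ 2 μ) :
    ∀ᵐ x ∂μ, l x * d x ≤ |z x + d x| - |z x| := by
  have hz := (Lp.memLp z).integrable one_le_two
  have hd := (Lp.memLp d).integrable one_le_two
  have hint : Integrable (fun x => |z x + d x| - |z x|) μ := (hz.add hd).abs.sub hz.abs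
  refine ae_le_of_forall_setIntegral_le (integrable_mul_L2 l d) hint fun s hs _ => ?_
  have h := hl (z + restrictLp hs d)
  rwa [add_sub_cancel_left, inner_restrictLp, psi_add_restrictLp_sub] at h

/-- The variational inequality over `Z_ad` holds pointwise. -/
lemma ae_nonneg_mul_of_variational_inequality {Ω : Type*} [MeasurableSpace Ω] {μ : Measure Ω}
    [IsFiniteMeasure μ] {a b c : ℝ} (hac : a ≤ c) (hcb : c ≤ b) {z g : Lp ℝ 2 μ}
    (hz : z ∈ Zad μ a b) (hVI : ∀ w ∈ Zad μ a b, 0 ≤ ⟪g, w - z⟫) :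
    ∀ᵐ x ∂μ, 0 ≤ g x * (c - z x) := by
  have hcz : Lp.const 2 μ c - z =ᵐ[μ] fun x => c - z x := by
    filter_upwards [Lp.coeFn_sub (Lp.const 2 μ c) z, Lp.coeFn_const (p := 2) (μ := μ) c]
      with x hsub hc
    rw [hsub, Pi.sub_apply, hc, Function.const_apply]
  have key : ∀ᵐ x ∂μ, 0 ≤ g x * (Lp.const 2 μ c - z : Lp ℝ 2 μ) x := by
    refine ae_nonneg_of_forall_setIntegral_nonneg (integrable_mul_L2 g _) fun s hs _ => ?_
    rw [← inner_restrictLp hs]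
    have hmem : z + restrictLp hs (Lp.const 2 μ c - z) ∈ Zad μ a b := by
      filter_upwards [hz, hcz, coeFn_restrictLp hs (Lp.const 2 μ c - z),
        Lp.coeFn_add z (restrictLp hs (Lp.const 2 μ c - z))] with x hzx hd hr hadd
      rw [hadd, Pi.add_apply, hr]
      by_cases h : x ∈ s
      · rw [Set.indicator_of_mem h, hd, add_sub_cancel]
        exact ⟨hac, hcb⟩
      · rwa [Set.indicator_of_notMem h, add_zero]
    simpa using hVI _ hmem
  filter_upwards [key, hcz] with x hx hd
  rwa [hd] at hx

/-- The pointwise optimality conditions determine the multiplier as a projection. -/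
lemma eq_proj_of_pointwise_conditions {a b σ ν z p l : ℝ} (ha : a < 0) (hb : 0 < b)
    (hσ : 0 < σ) (hν : 0 < ν) (hl : l ≤ 1) (hl' : -1 ≤ l) (hlz : |z| ≤ l * z)
    (hga : 0 ≤ (p + σ * z + ν * l) * (a - z)) (hgb : 0 ≤ (p + σ * z + ν * l) * (b - z)) :
    l = proj (-1) 1 (-(1 / ν) * p) := by
  have hq : -(1 / ν) * p = -p / ν := by ring
  rw [proj, hq]
  rcases lt_trichotomy z 0 with hz | rfl | hz
  · rw [abs_of_neg hz] at hlz
    have hl1 : l = -1 := by nlinarith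
    subst hl1
    have hg := nonneg_of_mul_nonneg_left hgb (by linarith)
    have hp : -p / ν ≤ -1 := by rw [div_le_iff₀ hν]; nlinarith
    rw [max_eq_left hp]; norm_num
  · have h1 := nonneg_of_mul_nonneg_left hgb (by linarith)
    have h2 : p + σ * 0 + ν * l ≤ 0 := by
      by_contra! h
      nlinarith
    have hp : -p / ν = l := by rw [div_eq_iff hν.ne']; linarith
    rw [hp, max_eq_right hl', min_eq_right hl]
  · rw [abs_of_pos hz] at hlz
    have hl1 : l = 1 := by nlinarith
    subst hl1
    have hg : p + σ * z + ν * 1 ≤ 0 := by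
      by_contra! h
      nlinarith
    have hp : 1 ≤ -p / ν := by rw [le_div_iff₀ hν]; nlinarith
    rw [min_eq_left (hp.trans (le_max_right _ _))]

/-- The subgradient satisfies
`λ̄(x) = Proj_{[−1,1]}(−(1/ν) p̄(x))` a.e. -/
theorem subgradient_projection_formula {Ω : Type*} [MeasurableSpace Ω] (μ : Measure Ω)
    [IsFiniteMeasure μ] (a b : ℝ) (ha : a < 0) (hb : 0 < b) (σ ν : ℝ) (hσ : 0 < σ) (hν : 0 < ν)
    (zb pb lb : Lp ℝ 2 μ) (hzb : zb ∈ Zad μ a b) (hlb : IsSubgradient (psi μ) zb lb)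
    (hVI : ∀ z ∈ Zad μ a b, 0 ≤ ⟪pb + σ • zb + ν • lb, z - zb⟫) :
    ∀ᵐ x ∂μ, lb x = proj (-1) 1 (-(1 / ν) * pb x) := by
  filter_upwards [hlb.ae_mul_le (Lp.const 2 μ 1), hlb.ae_mul_le (Lp.const 2 μ (-1)),
    hlb.ae_mul_le (-zb), Lp.coeFn_const (p := 2) (μ := μ) (1 : ℝ),
    Lp.coeFn_const (p := 2) (μ := μ) (-1 : ℝ), Lp.coeFn_neg zb,
    ae_nonneg_mul_of_variational_inequality le_rfl (ha.trans hb).le hzb hVI,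
    ae_nonneg_mul_of_variational_inequality (ha.trans hb).le le_rfl hzb hVI,
    Lp.coeFn_add (pb + σ • zb) (ν • lb), Lp.coeFn_add pb (σ • zb), Lp.coeFn_smul σ zb,
    Lp.coeFn_smul ν lb] with x h1 h2 h3 e1 e2 e3 hga hgb e4 e5 e6 e7
  rw [e1, Function.const_apply] at h1
  rw [e2, Function.const_apply] at h2
  simp only [e3, Pi.neg_apply, add_neg_cancel, abs_zero] at h3
  simp only [e4, e5, e6, e7, Pi.add_apply, Pi.smul_apply, smul_eq_mul] at hga hgb
  have t1 := abs_add_le (zb x) 1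
  have t2 := abs_add_le (zb x) (-1)
  rw [abs_one] at t1
  rw [abs_neg, abs_one] at t2
  exact eq_proj_of_pointwise_conditions ha hb hσ hν (by linarith) (by linarith) (by linarith)
    hga hgb
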